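/- Let d and d' be positive integers, v ∈ ℝ^d, and let h : [d] → [d'] and sgn : [d] → {−1,+1} be independent uniformly random functions. For k = 0,…,d define v'^{(k)} ∈ ℝ^{d'} by v'^{(k)}_i = Σ_{j ≤ k, h(j) = i} sgn(j)·v_j, and set X_k = ‖v'^{(k)}‖₂² − ‖v'^{(k−1)}‖₂² − v_k². Then for every k = 1,…,d, E[X_k² | X₁,…,X_{k−1}] = (4·v_k²/d')·‖v'^{(k−1)}‖₂². -/

import Mathlib

open MeasureTheory ProbabilityTheory Real Finset

noncomputable section

/-- Sample space for the random hash functions `h : [d] → [d']` and `sgn : [d] → {-1,+1}`. -/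
abbrev HashOmega (d d' : ℕ) : Type := (Fin d → Fin d') × (Fin d → Bool)

/-- The uniform probability measure on `HashOmega d d'`; this encodes that all values
`h(j)`, `sgn(j)` are mutually independent and uniformly distributed. -/
noncomputable def hashUnif (d d' : ℕ) [NeZero d'] : Measure (HashOmega d d') :=
  (PMF.uniformOfFintype (HashOmega d d')).toMeasure

/-- The sign `sgn(j) ∈ {-1,+1}` of coordinate `j` at sample point `ω`. -/
def hashSgn {d d' : ℕ} (ω : HashOmega d d') (j : Fin d) : ℝ :=
  if ω.2 j then 1 else -1

/-- The prefix vector `v'^{(k)} ∈ ℝ^{d'}`: feature hashing applied to the first `k`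
coordinates of `v`, i.e. `v'^{(k)}_i = ∑_{j ≤ k, h(j) = i} sgn(j)·v_j`.
For `k = d` this is the feature-hashed vector `v'` itself. -/
def prefixVec {d : ℕ} (d' : ℕ) (v : Fin d → ℝ) (k : ℕ) (ω : HashOmega d d') :
    Fin d' → ℝ :=
  fun i => ∑ j ∈ univ.filter (fun j : Fin d => (j : ℕ) < k ∧ ω.1 j = i),
    hashSgn ω j * v j

/-- Squared euclidean norm of a vector in `ℝ^n`. -/
def sqNorm {n : ℕ} (w : Fin n → ℝ) : ℝ := ∑ i, (w i) ^ 2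

/-- The martingale increments `X_k = ‖v'^{(k)}‖₂² − ‖v'^{(k−1)}‖₂² − v_k²`
(with `k` 1-indexed in the paper, so `Xinc d' v j` for `j : Fin d` is `X_{j+1}`). -/
def Xinc {d : ℕ} (d' : ℕ) (v : Fin d → ℝ) (j : Fin d) (ω : HashOmega d d') : ℝ :=
  sqNorm (prefixVec d' v ((j : ℕ) + 1) ω) - sqNorm (prefixVec d' v (j : ℕ) ω) - (v j) ^ 2

/-- The σ-algebra generated by `X₁, …, X_{k−1}`, i.e. by the increments `Xinc d' v i`
for `i < j`. -/
def XFilt {d : ℕ} (d' : ℕ) (v : Fin d → ℝ) (j : Fin d) : MeasurableSpace (HashOmega d d') :=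
  ⨆ (i : Fin d) (_ : i < j), MeasurableSpace.comap (Xinc d' v i) inferInstance

/-- Cyclically shift the hash value of coordinate `j` by `c`, leaving everything else unchanged. -/
def hashShift {d d' : ℕ} [NeZero d'] (j : Fin d) (c : Fin d') :
    HashOmega d d' ≃ HashOmega d d' :=
  (Equiv.addRight (Pi.single j c)).prodCongr (Equiv.refl _)

lemma hashShift_fst_self {d d' : ℕ} [NeZero d'] (j : Fin d) (c : Fin d') (ω : HashOmega d d') :
    (hashShift j c ω).1 j = ω.1 j + c := by
  simp [hashShift]

lemma hashShift_fst_of_ne {d d' : ℕ} [NeZero d'] {i j : Fin d} (hij : i ≠ j) (c : Fin d')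
    (ω : HashOmega d d') : (hashShift j c ω).1 i = ω.1 i := by
  simp [hashShift, hij]

lemma hashSgn_hashShift {d d' : ℕ} [NeZero d'] (i j : Fin d) (c : Fin d') (ω : HashOmega d d') :
    hashSgn (hashShift j c ω) i = hashSgn ω i := by
  simp [hashShift, hashSgn]

lemma prefixVec_hashShift {d d' : ℕ} [NeZero d'] (v : Fin d → ℝ) (j : Fin d) (c : Fin d')
    {k : ℕ} (hk : k ≤ j) (ω : HashOmega d d') :
    prefixVec d' v k (hashShift j c ω) = prefixVec d' v k ω := by
  funext i
  unfold prefixVec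
  simp only [hashSgn_hashShift]
  refine Finset.sum_congr (Finset.filter_congr fun l _ => and_congr_right fun hl => ?_)
    fun _ _ => rfl
  rw [hashShift_fst_of_ne (by rintro rfl; omega)]

lemma Xinc_hashShift {d d' : ℕ} [NeZero d'] (v : Fin d → ℝ) {i j : Fin d} (hij : i < j)
    (c : Fin d') (ω : HashOmega d d') :
    Xinc d' v i (hashShift j c ω) = Xinc d' v i ω := by
  have h : (i : ℕ) < j := hij
  simp only [Xinc, prefixVec_hashShift v j c h, prefixVec_hashShift v j c h.le]

lemma prefixVec_succ {d d' : ℕ} (v : Fin d → ℝ) (j : Fin d) (ω : HashOmega d d') (i : Fin d') :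
    prefixVec d' v ((j : ℕ) + 1) ω i =
      prefixVec d' v j ω i + if ω.1 j = i then hashSgn ω j * v j else 0 := by
  unfold prefixVec
  rw [Finset.sum_filter, Finset.sum_filter,
    ← Finset.sum_ite_eq' univ j (fun l => if ω.1 l = i then hashSgn ω l * v l else 0) |>.trans
      (if_pos (mem_univ j)), ← Finset.sum_add_distrib]
  refine Finset.sum_congr rfl fun l _ => ?_
  rcases lt_trichotomy l j with h | rfl | h
  · have h' : (l : ℕ) < j := h
    simp [h.ne, h', h'.trans (Nat.lt_succ_self _)]
  · simp
  · have h' : (j : ℕ) < l := h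
    simp [h.ne', h'.not_gt, show ¬ (l : ℕ) < j + 1 by omega]

/-- The cross term is the only part of the increment left after expanding the square. -/
lemma Xinc_eq {d d' : ℕ} (v : Fin d → ℝ) (j : Fin d) (ω : HashOmega d d') :
    Xinc d' v j ω = 2 * (hashSgn ω j * v j) * prefixVec d' v j ω (ω.1 j) := by
  have hs : hashSgn ω j ^ 2 = 1 := by unfold hashSgn; split_ifs <;> norm_num
  have key : ∀ i, prefixVec d' v ((j : ℕ) + 1) ω i ^ 2 = prefixVec d' v j ω i ^ 2 +
      if ω.1 j = i then
        2 * (hashSgn ω j * v j) * prefixVec d' v j ω i + v j ^ 2 else 0 := by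
    intro i
    rw [prefixVec_succ]
    split_ifs
    · linear_combination v j ^ 2 * hs
    · ring
  simp only [Xinc, sqNorm, key, Finset.sum_add_distrib, Finset.sum_ite_eq, mem_univ, if_true]
  ring

lemma Xinc_sq {d d' : ℕ} (v : Fin d → ℝ) (j : Fin d) (ω : HashOmega d d') :
    Xinc d' v j ω ^ 2 = 4 * v j ^ 2 * prefixVec d' v j ω (ω.1 j) ^ 2 := by
  have hs : hashSgn ω j ^ 2 = 1 := by unfold hashSgn; split_ifs <;> norm_num
  rw [Xinc_eq]
  linear_combination 4 * v j ^ 2 * prefixVec d' v j ω (ω.1 j) ^ 2 * hs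

lemma XFilt_le_invariants {d d' : ℕ} [NeZero d'] (v : Fin d → ℝ) (j : Fin d) (c : Fin d') :
    XFilt d' v j ≤ MeasurableSpace.invariants (hashShift j c) := by
  refine iSup₂_le fun i hi => ?_
  rintro _ ⟨t, -, rfl⟩
  refine MeasurableSpace.measurableSet_invariants.2 ⟨MeasurableSet.of_discrete, ?_⟩
  ext ω
  simp [Xinc_hashShift v hi]

lemma measurable_Xinc_XFilt {d d' : ℕ} (v : Fin d → ℝ) {i j : Fin d} (hij : i < j) :
    Measurable[XFilt d' v j] (Xinc d' v i) :=
  Measurable.mono (comap_measurable _) (le_iSup₂_of_le i hij le_rfl) le_rfl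

lemma measurable_sqNorm_prefixVec {d d' : ℕ} (v : Fin d → ℝ) (j : Fin d) :
    ∀ k : ℕ, k ≤ j → Measurable[XFilt d' v j] fun ω => sqNorm (prefixVec d' v k ω)
  | 0, _ => by simp [prefixVec, sqNorm]
  | k + 1, hk => by
    let i : Fin d := ⟨k, by omega⟩
    have h : (fun ω => sqNorm (prefixVec d' v (k + 1) ω)) =
        fun ω => Xinc d' v i ω + sqNorm (prefixVec d' v k ω) + v i ^ 2 := by
      funext ω
      simp only [Xinc, i]
      ring
    rw [h]
    have hi : i < j := Fin.lt_def.2 hk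
    exact ((measurable_Xinc_XFilt v hi).add
      (measurable_sqNorm_prefixVec v j k (by omega))).add_const _

/-- Averaging over the hash value of coordinate `j` on a set that does not depend on it. -/
lemma sum_indicator_prefixVec_sq {d d' : ℕ} [NeZero d'] (v : Fin d → ℝ) (j : Fin d)
    {s : Set (HashOmega d d')} (hs : MeasurableSet[XFilt d' v j] s) :
    ∑ ω, s.indicator (fun ω => sqNorm (prefixVec d' v j ω)) ω =
      d' * ∑ ω, s.indicator (fun ω => prefixVec d' v j ω (ω.1 j) ^ 2) ω := by
  classical
  have shift (c : Fin d') : ∑ ω, s.indicator (fun ω => prefixVec d' v j ω (ω.1 j + c) ^ 2) ω =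
      ∑ ω, s.indicator (fun ω => prefixVec d' v j ω (ω.1 j) ^ 2) ω := by
    rw [← Equiv.sum_comp (hashShift j c)
      (s.indicator (fun ω => prefixVec d' v j ω (ω.1 j) ^ 2))]
    refine Finset.sum_congr rfl fun ω _ => ?_
    have hinv := (MeasurableSpace.measurableSet_invariants.1
      (XFilt_le_invariants v j c s hs)).2
    have hmem : hashShift j c ω ∈ s ↔ ω ∈ s := by
      rw [← Set.mem_preimage, hinv]
    simp only [Set.indicator_apply, hmem, prefixVec_hashShift v j c le_rfl, hashShift_fst_self]
  calc _ = ∑ ω, ∑ c, s.indicator (fun ω => prefixVec d' v j ω (ω.1 j + c) ^ 2) ω := by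
        refine Finset.sum_congr rfl fun ω _ => ?_
        by_cases h : ω ∈ s
        · simp only [Set.indicator_of_mem h, sqNorm]
          exact (Equiv.sum_comp (Equiv.addLeft (ω.1 j))
            (fun i => prefixVec d' v j ω i ^ 2)).symm
        · simp [h]
    _ = _ := by
        rw [Finset.sum_comm]
        simp [shift]

lemma setIntegral_hashUnif {d d' : ℕ} [NeZero d'] (s : Set (HashOmega d d'))
    (f : HashOmega d d' → ℝ) :
    ∫ ω in s, f ω ∂hashUnif d d' =
      (Fintype.card (HashOmega d d') : ℝ)⁻¹ * ∑ ω, s.indicator f ω := by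
  rw [← integral_indicator MeasurableSet.of_discrete, hashUnif, PMF.integral_eq_sum,
    Finset.mul_sum]
  simp [PMF.uniformOfFintype_apply]

/-- **Conditional second moment of the feature hashing increments.**
With `h`, `sgn` independent uniformly random and `X_k = ‖v'^{(k)}‖₂² − ‖v'^{(k−1)}‖₂² − v_k²`,
we have `E[X_k² | X₁,…,X_{k−1}] = (4·v_k²/d')·‖v'^{(k−1)}‖₂²` for every `k = 1,…,d`. -/
theorem Xinc_condexp_sq
    (d d' : ℕ) [NeZero d] [NeZero d'] (v : Fin d → ℝ) (j : Fin d) :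
    (hashUnif d d')[fun ω => (Xinc d' v j ω) ^ 2 | XFilt d' v j] =ᵐ[hashUnif d d']
      fun ω => 4 * (v j) ^ 2 / (d' : ℝ) * sqNorm (prefixVec d' v (j : ℕ) ω) := by
  have : IsProbabilityMeasure (hashUnif d d') := by unfold hashUnif; infer_instance
  have hm : XFilt d' v j ≤ (inferInstance : MeasurableSpace (HashOmega d d')) :=
    fun s _ => MeasurableSet.of_discrete
  symm
  refine ae_eq_condExp_of_forall_setIntegral_eq hm .of_finite
    (fun _ _ _ => Integrable.of_finite.integrableOn) (fun s hs _ => ?_) ?_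
  · rw [setIntegral_hashUnif, setIntegral_hashUnif]
    simp only [Xinc_sq, Set.indicator_const_mul, ← Finset.mul_sum]
    rw [sum_indicator_prefixVec_sq v j hs]
    have : (d' : ℝ) ≠ 0 := NeZero.ne _
    field_simp
  · have h := (measurable_sqNorm_prefixVec (d' := d') v j j le_rfl).const_mul (4 * v j ^ 2 / (d' : ℝ))
    exact h.stronglyMeasurable.aestronglyMeasurable

end
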